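/- Let α, β > 0. For the scalar Douglas–Rachford model where ∂f̂(λ) = αλ + a and ∂ĝ(λ) = βλ + b, the residual of one DRS step with stepsize τ > 0, as a function of τ, is minimized at τ* = 1/√(αβ). -/

import Mathlib

/-- Closed form of the residual after one scalar Douglas–Rachford step. -/
theorem scalar_drs_residual {α β a b x y z τ : ℝ} (hα : 0 < α) (hβ : 0 < β) (hτ : 0 < τ)
    (hy : (y - x) / τ + (α * y + a) + (β * x + b) = 0)
    (hz : (z - x) / τ + (α * y + a) + (β * z + b) = 0) :
    (α + β) * z + (a + b) =
      ((α + β) * x + (a + b)) *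
        ((1 + α * β * τ ^ 2) / (1 + (α + β) * τ + α * β * τ ^ 2)) := by
  have hD : 1 + (α + β) * τ + α * β * τ ^ 2 ≠ 0 := by positivity
  field_simp at hy hz
  rw [← mul_div_assoc, eq_div_iff hD]
  linear_combination (α + β) * (1 + α * τ) * hz - (α + β) * α * τ * hy

/-- The contraction factor of the scalar Douglas–Rachford step, with `s ^ 2` the product and `p`
the sum of the two slopes, is smallest at stepsize `1 / s`. -/
theorem drs_factor_at_inv_le {s p τ : ℝ} (hs : 0 < s) (hp : 0 < p) (hτ : 0 < τ) :
    (1 + s ^ 2 * (1 / s) ^ 2) / (1 + p * (1 / s) + s ^ 2 * (1 / s) ^ 2) ≤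
      (1 + s ^ 2 * τ ^ 2) / (1 + p * τ + s ^ 2 * τ ^ 2) := by
  have h : s ^ 2 * (1 / s) ^ 2 = 1 := by field_simp
  have hps : p * (1 / s) * s = p := by field_simp
  have hq : 0 < p * (1 / s) := by positivity
  rw [h, div_le_div_iff₀ (by positivity) (by positivity)]
  generalize p * (1 / s) = q at hps hq
  subst hps
  nlinarith [mul_nonneg hq.le (sq_nonneg (s * τ - 1))]

/-- Scalar Douglas–Rachford model: with linear subgradients ∂f̂(λ̂)=αλ̂+a, ∂ĝ(λ)=βλ+b
    (α,β>0), the DRS steps with stepsize τ determine λ̂(τ), λ¹(τ); the residual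
    r(τ) = |(α+β)λ¹(τ) + (a+b)| is minimized over τ > 0 at τ = 1/√(αβ). -/
theorem stmt_6 (α β a b lamk : ℝ) (hα : 0 < α) (hβ : 0 < β)
    (lhat l1 : ℝ → ℝ)
    (hDRS1 : ∀ τ, 0 < τ → (lhat τ - lamk) / τ + (α * lhat τ + a) + (β * lamk + b) = 0)
    (hDRS2 : ∀ τ, 0 < τ → (l1 τ - lamk) / τ + (α * lhat τ + a) + (β * l1 τ + b) = 0) :
    ∀ τ, 0 < τ →
      |(α + β) * l1 (1 / Real.sqrt (α * β)) + (a + b)| ≤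
        |(α + β) * l1 τ + (a + b)| := by
  intro τ hτ
  have hs : 0 < Real.sqrt (α * β) := Real.sqrt_pos.2 (mul_pos hα hβ)
  have hσ : 0 < 1 / Real.sqrt (α * β) := one_div_pos.2 hs
  rw [scalar_drs_residual hα hβ hσ (hDRS1 _ hσ) (hDRS2 _ hσ),
    scalar_drs_residual hα hβ hτ (hDRS1 _ hτ) (hDRS2 _ hτ), abs_mul, abs_mul]
  refine mul_le_mul_of_nonneg_left ?_ (abs_nonneg _)
  rw [abs_of_nonneg (by positivity), abs_of_nonneg (by positivity)]
  have key := drs_factor_at_inv_le hs (add_pos hα hβ) hτ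
  rwa [Real.sq_sqrt (mul_pos hα hβ).le] at key
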